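/- arXiv:2502.20835 — 2 statements merged into one kernel-verified Lean document; each statement's English description precedes it below -/
import Mathlib

section
/- (Reconstruction Liveness characterization.) Suppose each guardian set has size exactly k, i.e. |Gᵢ| = k for all i ∈ D, and let C ⊆ P be the corrupted set. Then there exists a set S ∈ R with S ⊆ P \ C if and only if for every i ∈ D, either i ∉ C or |C ∩ Gᵢ| ≤ k − t. -/
/-- The family of reconstruction-capable sets:
`S ∈ R` iff `S ⊆ P` and for every participant `i ∈ D`, either `i ∈ S`
or at least `t` of `i`'s guardians belong to `S`. -/
def ReconCapable {α : Type*} [DecidableEq α] (P D : Finset α) (G : α → Finset α)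
    (t : ℕ) (S : Finset α) : Prop :=
  S ⊆ P ∧ ∀ i ∈ D, i ∈ S ∨ t ≤ (S ∩ G i).card

/-- Reconstruction Liveness characterization: assuming each guardian set has
size exactly `k` (with `t ≤ k`, a `(t,k)`-threshold scheme), there exists a
reconstruction-capable set `S ∈ R` with `S ⊆ P \ C` iff for every `i ∈ D`,
either `i ∉ C` or `(C ∩ Gᵢ).card ≤ k - t`. -/
theorem reconstruction_liveness {α : Type*} [DecidableEq α]
    (P D : Finset α) (G : α → Finset α) (t k : ℕ) (htk : t ≤ k)
    (hD : D ⊆ P) (hG : ∀ i ∈ D, G i ⊆ P ∧ i ∉ G i)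
    (hk : ∀ i ∈ D, (G i).card = k)
    (C : Finset α) (hC : C ⊆ P) :
    (∃ S, ReconCapable P D G t S ∧ S ⊆ P \ C) ↔
      ∀ i ∈ D, i ∉ C ∨ (C ∩ G i).card ≤ k - t := by
  have card_compl_inter (i : α) (hi : i ∈ D) :
      ((P \ C) ∩ G i).card + (C ∩ G i).card = k := by
    have h : (P \ C) ∩ G i = G i \ C := by
      ext x
      have := @(hG i hi).1 x
      simp only [Finset.mem_inter, Finset.mem_sdiff]
      tauto
    rw [h, Finset.inter_comm, Finset.card_sdiff_add_card_inter, hk i hi]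
  constructor
  · rintro ⟨S, ⟨-, hS⟩, hSC⟩ i hi
    rcases hS i hi with hiS | hcard
    · exact Or.inl (Finset.mem_sdiff.mp (hSC hiS)).2
    · right
      have hle := Finset.card_le_card (Finset.inter_subset_inter_right hSC (u := G i))
      have := card_compl_inter i hi
      omega
  · intro h
    refine ⟨P \ C, ⟨Finset.sdiff_subset, fun i hi => ?_⟩, subset_rfl⟩
    rcases h i hi with hiC | hcard
    · exact Or.inl (Finset.mem_sdiff.mpr ⟨hD hi, hiC⟩)
    · right
      have := card_compl_inter i hi
      omega
end

section
/- (Shamir perfect privacy, counting form.) Let q be a prime, t ≥ 1, s a finite set of nonzero elements of ZMod q with |s| ≤ t − 1, v : ZMod q → ZMod q an assignment of share values, and a ∈ ZMod q a secret. Then the number of polynomials f over ZMod q with degree < t satisfying f(0) = a and f(x) = v(x) for all x ∈ s equals q^(t − 1 − |s|). In particular, this count is the same for every secret a, so fewer than t shares reveal no information about the secret. -/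
open Polynomial in
/-- A polynomial with the same values as `p` at the nodes `s` differs from `p` by a multiple of the
nodal polynomial of `s`. -/
theorem Lagrange.nodal_dvd_sub_of_eval_eq {F : Type*} [Field F] {s : Finset F} {f p : F[X]}
    (h : ∀ x ∈ s, f.eval x = p.eval x) : Lagrange.nodal s id ∣ f - p := by
  rw [Lagrange.nodal]
  refine Finset.prod_dvd_of_coprime (fun x _ y _ hxy => ?_) fun x hx => ?_
  · exact isCoprime_X_sub_C_of_isUnit_sub (sub_ne_zero.mpr hxy).isUnit
  · rw [dvd_iff_isRoot]
    simp [h x hx]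

open Polynomial in
/-- The number of polynomials of degree less than `#s + k` with prescribed values on `s`. -/
theorem Polynomial.card_degree_lt_eval_eq {F : Type*} [Field F] (s : Finset F) (r : F → F)
    (k : ℕ) :
    Nat.card {f : F[X] // f.degree < ((s.card + k : ℕ) : WithBot ℕ) ∧ ∀ x ∈ s, f.eval x = r x}
      = Nat.card F ^ k := by
  classical
  have hinj : Set.InjOn (id : F → F) s := Set.injOn_id _
  set p := Lagrange.interpolate s id r
  set N := Lagrange.nodal s (id : F → F)
  have hN : N ≠ 0 := Lagrange.nodal_ne_zero
  have hp : ∀ x ∈ s, p.eval x = r x := fun x hx => Lagrange.eval_interpolate_at_node r hinj hx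
  have hNs : ∀ x ∈ s, N.eval x = 0 := fun x hx => Lagrange.eval_nodal_at_node (v := id) hx
  have hdp : p.degree < ((s.card + k : ℕ) : WithBot ℕ) :=
    (Lagrange.degree_interpolate_lt r hinj).trans_le (by exact_mod_cast Nat.le_add_right _ _)
  have hdN (g : F[X]) :
      (N * g).degree < ((s.card + k : ℕ) : WithBot ℕ) ↔ g.degree < (k : WithBot ℕ) := by
    rcases eq_or_ne g 0 with rfl | hg
    · simp
    · rw [degree_mul, Lagrange.degree_nodal, degree_eq_natDegree hg]
      norm_cast
      omega
  let φ : degreeLT F k → {f : F[X] //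
      f.degree < ((s.card + k : ℕ) : WithBot ℕ) ∧ ∀ x ∈ s, f.eval x = r x} := fun g =>
    ⟨p + N * g, (degree_add_le _ _).trans_lt
      (max_lt hdp ((hdN g).mpr (mem_degreeLT.mp g.2))), fun x hx => by simp [hp x hx, hNs x hx]⟩
  have hφ : Function.Bijective φ := by
    constructor
    · intro g g' h
      exact Subtype.ext (mul_left_cancel₀ hN (add_left_cancel (congrArg Subtype.val h)))
    · rintro ⟨f, hf, hfs⟩
      obtain ⟨g, hg⟩ := Lagrange.nodal_dvd_sub_of_eval_eq
        (fun x hx => (hfs x hx).trans (hp x hx).symm)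
      have hdg : g.degree < (k : WithBot ℕ) := by
        rw [← hdN, ← hg]
        exact (degree_sub_le _ _).trans_lt (max_lt hf hdp)
      exact ⟨⟨g, mem_degreeLT.mpr hdg⟩, Subtype.ext (by simp [φ, N, ← hg])⟩
  rw [← Nat.card_congr (Equiv.ofBijective φ hφ), Nat.card_congr (degreeLTEquiv F k).toEquiv,
    Nat.card_fun, Nat.card_fin]


/-- Shamir perfect privacy, counting form: over `ZMod q` (`q` prime), for
`t ≥ 1`, a set `s` of at most `t - 1` nonzero share points, share values `v`,
and any secret `a`, the number of polynomials `f` with `deg f < t`,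
`f(0) = a`, and `f(x) = v(x)` for all `x ∈ s` equals `q ^ (t - 1 - |s|)`;
in particular the count does not depend on `a`. -/
theorem shamir_perfect_privacy_count (q : ℕ) [Fact q.Prime] (t : ℕ) (ht : 1 ≤ t)
    (s : Finset (ZMod q)) (hs : (0 : ZMod q) ∉ s) (hcard : s.card ≤ t - 1)
    (v : ZMod q → ZMod q) (a : ZMod q) :
    Nat.card {f : Polynomial (ZMod q) //
        f.degree < (t : ℕ) ∧ f.eval 0 = a ∧ ∀ x ∈ s, f.eval x = v x}
      = q ^ (t - 1 - s.card) := by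
  classical
  have hdeg : (insert 0 s).card + (t - 1 - s.card) = t := by
    rw [Finset.card_insert_of_notMem hs]
    omega
  have key := Polynomial.card_degree_lt_eval_eq (insert 0 s) (Function.update v 0 a)
    (t - 1 - s.card)
  rw [hdeg, Nat.card_zmod] at key
  rw [← key]
  refine Nat.card_congr (Equiv.subtypeEquivRight fun f => and_congr_right fun _ => ?_)
  rw [Finset.forall_mem_insert, Function.update_self]
  refine and_congr_right fun _ => forall₂_congr fun x hx => ?_
  rw [Function.update_of_ne (ne_of_mem_of_not_mem hx hs)]
end
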